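/- arXiv:1403.3285 — 3 statements merged into one kernel-verified Lean document; each statement's English description precedes it below -/
import Mathlib

section
/- For every natural number n ≥ 1, all indices i, j ∈ {1,2}, and all real numbers 0 ≤ s ≤ t, the second-level iterated integral of the canonical lift of hⁿ satisfies the uniform bound |∫ₛᵗ (hⁿ·ⁱ_u − hⁿ·ⁱ_s) · (hⁿ·ʲ)′(u) du| ≤ 2·(t − s), with the bound independent of n. -/
/-- Components of the spinning path: `hⁿ·¹_t = (1/n) cos(n²t)`, `hⁿ·²_t = (1/n) sin(n²t)`. -/
noncomputable def hc (n : ℕ) : Fin 2 → ℝ → ℝ :=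
  ![fun t => (1 / (n : ℝ)) * Real.cos ((n : ℝ) ^ 2 * t),
    fun t => (1 / (n : ℝ)) * Real.sin ((n : ℝ) ^ 2 * t)]

theorem abs_hc_le (n : ℕ) (i : Fin 2) (t : ℝ) : |hc n i t| ≤ 1 / (n : ℝ) := by
  have hn : 0 ≤ 1 / (n : ℝ) := by positivity
  fin_cases i
  · simpa [hc, abs_mul] using
      mul_le_mul_of_nonneg_left (Real.abs_cos_le_one ((n : ℝ) ^ 2 * t)) hn
  · simpa [hc, abs_mul] using
      mul_le_mul_of_nonneg_left (Real.abs_sin_le_one ((n : ℝ) ^ 2 * t)) hn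

theorem abs_deriv_hc_le {n : ℕ} (hn : 1 ≤ n) (i : Fin 2) (t : ℝ) :
    |deriv (hc n i) t| ≤ n := by
  have hn0 : (n : ℝ) ≠ 0 := by positivity
  have hlin : HasDerivAt (fun x : ℝ => (n : ℝ) ^ 2 * x) ((n : ℝ) ^ 2) t := by
    simpa using (hasDerivAt_id t).const_mul ((n : ℝ) ^ 2)
  fin_cases i
  · have h : HasDerivAt (hc n 0) (-(n * Real.sin ((n : ℝ) ^ 2 * t))) t :=
      (hlin.cos.const_mul (1 / (n : ℝ))).congr_deriv (by field_simp)
    change |deriv (hc n 0) t| ≤ n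
    rw [h.deriv, abs_neg, abs_mul, Nat.abs_cast]
    exact mul_le_of_le_one_right n.cast_nonneg (Real.abs_sin_le_one _)
  · have h : HasDerivAt (hc n 1) (n * Real.cos ((n : ℝ) ^ 2 * t)) t :=
      (hlin.sin.const_mul (1 / (n : ℝ))).congr_deriv (by field_simp)
    change |deriv (hc n 1) t| ≤ n
    rw [h.deriv, abs_mul, Nat.abs_cast]
    exact mul_le_of_le_one_right n.cast_nonneg (Real.abs_cos_le_one _)

/-- For every `n ≥ 1`, indices `i, j ∈ {1,2}` and `0 ≤ s ≤ t`, the second-level iterated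
integral `𝕏ⁿ·ⁱʲ_{s,t} = ∫ₛᵗ (hⁿ·ⁱ_u − hⁿ·ⁱ_s)·(hⁿ·ʲ)′(u) du` of the canonical lift of `hⁿ`
satisfies the uniform bound `|𝕏ⁿ·ⁱʲ_{s,t}| ≤ 2(t − s)`, independently of `n`. -/
theorem stmt4 :
    ∀ n : ℕ, 1 ≤ n → ∀ i j : Fin 2, ∀ s t : ℝ, 0 ≤ s → s ≤ t →
      |∫ u in s..t, (hc n i u - hc n i s) * deriv (hc n j) u| ≤ 2 * (t - s) := by
  intro n hn i j s t _ hst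
  have hn0 : (n : ℝ) ≠ 0 := by positivity
  have hbound (u : ℝ) : ‖(hc n i u - hc n i s) * deriv (hc n j) u‖ ≤ 2 := by
    rw [Real.norm_eq_abs, abs_mul]
    calc |hc n i u - hc n i s| * |deriv (hc n j) u|
        ≤ (1 / (n : ℝ) + 1 / n) * n := by
          gcongr
          · exact (abs_sub _ _).trans (add_le_add (abs_hc_le n i u) (abs_hc_le n i s))
          · exact abs_deriv_hc_le hn j u
      _ = 2 := by field_simp; norm_num
  simpa [abs_of_nonneg (sub_nonneg.2 hst)] using
    intervalIntegral.norm_integral_le_of_norm_le_const (a := s) (b := t) fun u _ => hbound u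
end

section
/- Let A be the 2×2 matrix with entries A₁₂ = 1/2, A₂₁ = −1/2, A₁₁ = A₂₂ = 0. For every natural number n ≥ 1, all indices i, j ∈ {1,2}, and all 0 ≤ s ≤ t ≤ 1, one has |∫ₛᵗ (hⁿ·ⁱ_u − hⁿ·ⁱ_s)·(hⁿ·ʲ)′(u) du − A_{ij}·(t − s)| ≤ 3/n². In particular, uniformly in (s,t), the second level of the canonical lift of hⁿ converges as n → ∞ to the area process (t−s)·A of the pure area rough path. -/
/-- The matrix `A` with `A₁₂ = 1/2`, `A₂₁ = −1/2`, `A₁₁ = A₂₂ = 0`. -/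
noncomputable def Amat : Fin 2 → Fin 2 → ℝ := ![![0, 1 / 2], ![-(1 / 2), 0]]

theorem hasDerivAt_cos_const_mul (c u : ℝ) :
    HasDerivAt (fun x => Real.cos (c * x)) (-(c * Real.sin (c * u))) u := by
  refine HasDerivAt.congr_deriv (((hasDerivAt_id' u).const_mul c).cos) ?_
  ring

theorem hasDerivAt_sin_const_mul (c u : ℝ) :
    HasDerivAt (fun x => Real.sin (c * x)) (c * Real.cos (c * u)) u := by
  refine HasDerivAt.congr_deriv (((hasDerivAt_id' u).const_mul c).sin) ?_
  ring

theorem deriv_hc_zero {n : ℕ} (hn : 1 ≤ n) (u : ℝ) :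
    deriv (hc n 0) u = -(n * Real.sin ((n : ℝ) ^ 2 * u)) := by
  have hn0 : (n : ℝ) ≠ 0 := by positivity
  have h := (hasDerivAt_cos_const_mul ((n : ℝ) ^ 2) u).const_mul (1 / (n : ℝ))
  refine (HasDerivAt.deriv (f := hc n 0) h).trans ?_
  field_simp

theorem deriv_hc_one {n : ℕ} (hn : 1 ≤ n) (u : ℝ) :
    deriv (hc n 1) u = n * Real.cos ((n : ℝ) ^ 2 * u) := by
  have hn0 : (n : ℝ) ≠ 0 := by positivity
  have h := (hasDerivAt_sin_const_mul ((n : ℝ) ^ 2) u).const_mul (1 / (n : ℝ))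
  refine (HasDerivAt.deriv (f := hc n 1) h).trans ?_
  field_simp

/-- If `f` has an antiderivative of the form `a * u + G u / c`, then its integral differs from
`a * (t - s)` by at most `K / c`, where `K` bounds the increment of `G`. -/
theorem abs_integral_sub_mul_le {f G : ℝ → ℝ} {a c s t K : ℝ} (hc0 : 0 < c)
    (hf : Continuous f) (hG : ∀ u, HasDerivAt G (c * (f u - a)) u) (hb : |G t - G s| ≤ K) :
    |(∫ u in s..t, f u) - a * (t - s)| ≤ K / c := by
  have hF : ∀ u ∈ Set.uIcc s t, HasDerivAt (fun x => a * x + G x / c) (f u) u := by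
    intro u _
    refine HasDerivAt.congr_deriv (((hasDerivAt_id' u).const_mul a).add ((hG u).div_const c)) ?_
    field_simp; ring
  rw [intervalIntegral.integral_eq_sub_of_hasDerivAt hF (hf.intervalIntegrable s t)]
  have h : a * t + G t / c - (a * s + G s / c) - a * (t - s) = (G t - G s) / c := by ring
  rw [h, abs_div, abs_of_pos hc0]
  gcongr

/-- For every `n ≥ 1`, indices `i, j ∈ {1,2}` and `0 ≤ s ≤ t ≤ 1`, one has
`|𝕏ⁿ·ⁱʲ_{s,t} − A_{ij}·(t − s)| ≤ 3/n²`; so uniformly in `(s,t)` the second level of the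
canonical lift of `hⁿ` converges to the area process `(t−s)·A` of the pure area rough path. -/
theorem stmt6 :
    ∀ n : ℕ, 1 ≤ n → ∀ i j : Fin 2, ∀ s t : ℝ, 0 ≤ s → s ≤ t → t ≤ 1 →
      |(∫ u in s..t, (hc n i u - hc n i s) * deriv (hc n j) u) - Amat i j * (t - s)| ≤
        3 / (n : ℝ) ^ 2 := by
  intro n hn i j s t _ _ _
  have hn0 : (n : ℝ) ≠ 0 := by positivity
  have hc0 : (0 : ℝ) < (n : ℝ) ^ 2 := by positivity
  have hcos := hasDerivAt_cos_const_mul ((n : ℝ) ^ 2)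
  have hsin := hasDerivAt_sin_const_mul ((n : ℝ) ^ 2)
  have hs := Real.sin_sq_add_cos_sq ((n : ℝ) ^ 2 * s)
  have ht := Real.sin_sq_add_cos_sq ((n : ℝ) ^ 2 * t)
  fin_cases i <;> fin_cases j <;>
    simp only [Fin.zero_eta, Fin.mk_one, deriv_hc_zero hn, deriv_hc_one hn] <;>
    simp only [hc, Amat, Matrix.cons_val_zero, Matrix.cons_val_one]
  · refine abs_integral_sub_mul_le
      (G := fun u => (Real.cos ((n : ℝ) ^ 2 * u) - Real.cos ((n : ℝ) ^ 2 * s)) ^ 2 / 2)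
      hc0 (by fun_prop) (fun u => ?_) ?_
    · refine HasDerivAt.congr_deriv ((((hcos u).sub_const (Real.cos ((n : ℝ) ^ 2 * s))).pow 2).div_const 2) ?_
      field_simp; ring
    · rw [abs_le]; constructor <;> nlinarith [sq_nonneg
        (Real.cos ((n : ℝ) ^ 2 * t) + Real.cos ((n : ℝ) ^ 2 * s))]
  · refine abs_integral_sub_mul_le
      (G := fun u => Real.sin ((n : ℝ) ^ 2 * u) * Real.cos ((n : ℝ) ^ 2 * u) / 2
        - Real.cos ((n : ℝ) ^ 2 * s) * Real.sin ((n : ℝ) ^ 2 * u))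
      hc0 (by fun_prop) (fun u => ?_) ?_
    · refine HasDerivAt.congr_deriv ((((hsin u).mul (hcos u)).div_const 2).sub
        ((hsin u).const_mul (Real.cos ((n : ℝ) ^ 2 * s)))) ?_
      have hu := Real.sin_sq_add_cos_sq ((n : ℝ) ^ 2 * u)
      field_simp
      linear_combination -hu
    · generalize Real.sin ((n : ℝ) ^ 2 * s) = p at *
      generalize Real.cos ((n : ℝ) ^ 2 * s) = q at *
      generalize Real.sin ((n : ℝ) ^ 2 * t) = x at *
      generalize Real.cos ((n : ℝ) ^ 2 * t) = y at *
      rw [abs_le]; constructor <;> nlinarith [sq_nonneg (x + y), sq_nonneg (x - y),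
        sq_nonneg (p + q), sq_nonneg (p - q), sq_nonneg (x + q), sq_nonneg (x - q)]
  · refine abs_integral_sub_mul_le
      (G := fun u => Real.sin ((n : ℝ) ^ 2 * u) * Real.cos ((n : ℝ) ^ 2 * u) / 2
        - Real.sin ((n : ℝ) ^ 2 * s) * Real.cos ((n : ℝ) ^ 2 * u))
      hc0 (by fun_prop) (fun u => ?_) ?_
    · refine HasDerivAt.congr_deriv ((((hsin u).mul (hcos u)).div_const 2).sub
        ((hcos u).const_mul (Real.sin ((n : ℝ) ^ 2 * s)))) ?_
      have hu := Real.sin_sq_add_cos_sq ((n : ℝ) ^ 2 * u)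
      field_simp
      linear_combination hu
    · generalize Real.sin ((n : ℝ) ^ 2 * s) = p at *
      generalize Real.cos ((n : ℝ) ^ 2 * s) = q at *
      generalize Real.sin ((n : ℝ) ^ 2 * t) = x at *
      generalize Real.cos ((n : ℝ) ^ 2 * t) = y at *
      rw [abs_le]; constructor <;> nlinarith [sq_nonneg (x + y), sq_nonneg (x - y),
        sq_nonneg (p + q), sq_nonneg (p - q), sq_nonneg (y + p), sq_nonneg (y - p)]
  · refine abs_integral_sub_mul_le
      (G := fun u => (Real.sin ((n : ℝ) ^ 2 * u) - Real.sin ((n : ℝ) ^ 2 * s)) ^ 2 / 2)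
      hc0 (by fun_prop) (fun u => ?_) ?_
    · refine HasDerivAt.congr_deriv ((((hsin u).sub_const (Real.sin ((n : ℝ) ^ 2 * s))).pow 2).div_const 2) ?_
      field_simp; ring
    · rw [abs_le]; constructor <;> nlinarith [sq_nonneg
        (Real.sin ((n : ℝ) ^ 2 * t) + Real.sin ((n : ℝ) ^ 2 * s))]
end

section
/- Let V₁, V₂ : ℝ² → ℝ² be smooth (C^∞) vector fields that are bounded and have bounded derivatives of every order. For each natural number n ≥ 1 let xⁿ : [0,1] → ℝ² be the solution of the ordinary differential equation (xⁿ)′(t) = (hⁿ·¹)′(t)·V₁(xⁿ_t) + (hⁿ·²)′(t)·V₂(xⁿ_t), i.e. (xⁿ)′(t) = −n sin(n²t)·V₁(xⁿ_t) + n cos(n²t)·V₂(xⁿ_t), with xⁿ_0 = ξ, and let x : [0,1] → ℝ² be the solution of x′(t) = (1/2)·[V₁,V₂](x_t) with x_0 = ξ, where [V₁,V₂](y) = DV₂(y)(V₁(y)) − DV₁(y)(V₂(y)) is the Lie bracket. Then xⁿ converges to x uniformly on [0,1] as n → ∞. -/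
section Averaging

variable {E : Type*} [NormedAddCommGroup E] [NormedSpace ℝ E]

/-- The derivative of a vector field with two bounded derivatives along a bounded vector field with
bounded derivative is differentiable, and it is bounded with bounded derivative. -/
theorem exists_bound_fderiv_apply {V W : E → E} (hV : ContDiff ℝ 2 V) (hW : ContDiff ℝ 1 W)
    (hVb : ∀ k : ℕ, ∃ C : ℝ, ∀ y, ‖iteratedFDeriv ℝ k V y‖ ≤ C)
    (hWb : ∀ k : ℕ, ∃ C : ℝ, ∀ y, ‖iteratedFDeriv ℝ k W y‖ ≤ C) :
    Differentiable ℝ (fun y => fderiv ℝ V y (W y)) ∧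
      ∃ C : ℝ, ∀ y, ‖fderiv ℝ V y (W y)‖ ≤ C ∧ ‖fderiv ℝ (fun y => fderiv ℝ V y (W y)) y‖ ≤ C := by
  obtain ⟨v₁, hv₁⟩ := hVb 1
  obtain ⟨v₂, hv₂⟩ := hVb 2
  obtain ⟨w₀, hw₀⟩ := hWb 0
  obtain ⟨w₁, hw₁⟩ := hWb 1
  simp only [norm_iteratedFDeriv_zero] at hw₀
  simp only [norm_iteratedFDeriv_one] at hv₁ hw₁
  have hv₂' : ∀ y, ‖fderiv ℝ (fderiv ℝ V) y‖ ≤ v₂ := fun y => by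
    rw [← norm_iteratedFDeriv_one, norm_iteratedFDeriv_fderiv]
    exact hv₂ y
  have hdV : Differentiable ℝ (fderiv ℝ V) :=
    (hV.fderiv_right (m := 1) (by norm_num)).differentiable (by norm_num)
  have hdW : Differentiable ℝ W := hW.differentiable (by norm_num)
  refine ⟨hdV.clm_apply hdW, max (v₁ * w₀) (v₁ * w₁ + v₂ * w₀), fun y => ⟨?_, ?_⟩⟩
  · refine le_max_of_le_left ((ContinuousLinearMap.le_opNorm _ _).trans ?_)
    exact mul_le_mul (hv₁ y) (hw₀ y) (norm_nonneg _) ((norm_nonneg _).trans (hv₁ y))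
  · refine le_max_of_le_right ?_
    rw [fderiv_clm_apply (hdV y) (hdW y)]
    refine (norm_add_le _ _).trans (add_le_add ?_ ?_)
    · exact (ContinuousLinearMap.opNorm_comp_le _ _).trans
        (mul_le_mul (hv₁ y) (hw₁ y) (norm_nonneg _) ((norm_nonneg _).trans (hv₁ y)))
    · refine (ContinuousLinearMap.le_opNorm _ _).trans ?_
      rw [ContinuousLinearMap.opNorm_flip]
      exact mul_le_mul (hv₂' y) (hw₀ y) (norm_nonneg _) ((norm_nonneg _).trans (hv₂' y))

/-- Triangle inequality for a combination of two vectors sharing a norm bound. -/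
theorem norm_smul_add_smul_le {a b c d K : ℝ} {u v : E} (ha : |a| ≤ c) (hb : |b| ≤ d)
    (hu : ‖u‖ ≤ K) (hv : ‖v‖ ≤ K) : ‖a • u + b • v‖ ≤ (c + d) * K := by
  refine (norm_add_le _ _).trans ?_
  rw [norm_smul, norm_smul, Real.norm_eq_abs, Real.norm_eq_abs, add_mul]
  exact add_le_add (mul_le_mul ha hu (norm_nonneg _) ((abs_nonneg _).trans ha))
    (mul_le_mul hb hv (norm_nonneg _) ((abs_nonneg _).trans hb))

/-- A trajectory driven by the circular path of radius `1 / N` and angular speed `N ^ 2` stays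
`O(1 / N)`-close to the trajectory of half the Lie bracket. -/
theorem dist_le_of_circular_driver {V₁ V₂ : E → E} {C N : ℝ} (hC : 1 ≤ C) (hN : 1 ≤ N)
    {W : (E → E) → (E → E) → E → E} (hW : W = fun U U' y => fderiv ℝ U y (U' y))
    (hV₁ : Differentiable ℝ V₁) (hV₂ : Differentiable ℝ V₂)
    (hV₁b : ∀ y, ‖V₁ y‖ ≤ C) (hV₂b : ∀ y, ‖V₂ y‖ ≤ C)
    (hd : ∀ U ∈ ({V₁, V₂} : Set (E → E)), ∀ U' ∈ ({V₁, V₂} : Set (E → E)),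
      Differentiable ℝ (W U U') ∧ ∀ y, ‖W U U' y‖ ≤ C ∧ ‖fderiv ℝ (W U U') y‖ ≤ C)
    {u x : ℝ → E} (h0 : u 0 = x 0)
    (hu : ∀ t ∈ Set.Icc (0 : ℝ) 1, HasDerivAt u
      ((-N * Real.sin (N ^ 2 * t)) • V₁ (u t) + (N * Real.cos (N ^ 2 * t)) • V₂ (u t)) t)
    (hx : ∀ t ∈ Set.Icc (0 : ℝ) 1, HasDerivAt x ((1 / 2 : ℝ) • (W V₂ V₁ (x t) - W V₁ V₂ (x t))) t)
    {t : ℝ} (ht : t ∈ Set.Icc (0 : ℝ) 1) :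
    dist (u t) (x t) ≤ (3 * C + 8 * C * Real.exp C) / N := by
  have hN0 : 0 < N := by linarith
  have hC0 : 0 < C := by linarith
  obtain ⟨d₁₁, b₁₁⟩ := hd V₁ (by simp) V₁ (by simp)
  obtain ⟨d₁₂, b₁₂⟩ := hd V₁ (by simp) V₂ (by simp)
  obtain ⟨d₂₁, b₂₁⟩ := hd V₂ (by simp) V₁ (by simp)
  obtain ⟨d₂₂, b₂₂⟩ := hd V₂ (by simp) V₂ (by simp)
  set F : E → E := fun y => (1 / 2 : ℝ) • (W V₂ V₁ y - W V₁ V₂ y) with hF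
  set A : E → E := fun y => W V₁ V₁ y - W V₂ V₂ y with hA
  set B : E → E := fun y => W V₁ V₂ y + W V₂ V₁ y with hB
  set p : ℝ → ℝ := fun t => (Real.cos (N ^ 2 * t) ^ 2 - Real.sin (N ^ 2 * t) ^ 2) / (4 * N ^ 2)
    with hp
  set q : ℝ → ℝ := fun t => Real.sin (N ^ 2 * t) * Real.cos (N ^ 2 * t) / (2 * N ^ 2) with hq
  set z : ℝ → E := fun t => u t -
    ((Real.cos (N ^ 2 * t) / N) • V₁ (u t) + (Real.sin (N ^ 2 * t) / N) • V₂ (u t)) +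
    (p t • A (u t) + q t • B (u t)) with hz
  have dA : Differentiable ℝ A := d₁₁.sub d₂₂
  have dB : Differentiable ℝ B := d₁₂.add d₂₁
  have bA : ∀ y, ‖A y‖ ≤ 2 * C := fun y =>
    (norm_sub_le _ _).trans (by linarith [(b₁₁ y).1, (b₂₂ y).1])
  have bB : ∀ y, ‖B y‖ ≤ 2 * C := fun y =>
    (norm_add_le _ _).trans (by linarith [(b₁₂ y).1, (b₂₁ y).1])
  have bA' : ∀ y, ‖fderiv ℝ A y‖ ≤ 2 * C := fun y => by
    rw [hA, fderiv_fun_sub (d₁₁ y) (d₂₂ y)]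
    exact (norm_sub_le _ _).trans (by linarith [(b₁₁ y).2, (b₂₂ y).2])
  have bB' : ∀ y, ‖fderiv ℝ B y‖ ≤ 2 * C := fun y => by
    rw [hB, fderiv_fun_add (d₁₂ y) (d₂₁ y)]
    exact (norm_add_le _ _).trans (by linarith [(b₁₂ y).2, (b₂₁ y).2])
  have hFL : LipschitzWith C.toNNReal F := by
    refine lipschitzWith_of_nnnorm_fderiv_le ((d₂₁.sub d₁₂).const_smul _) fun y => ?_
    have e : fderiv ℝ F y = (1 / 2 : ℝ) • (fderiv ℝ (W V₂ V₁) y - fderiv ℝ (W V₁ V₂) y) :=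
      (((d₂₁ y).hasFDerivAt.sub (d₁₂ y).hasFDerivAt).const_smul _).fderiv
    rw [← NNReal.coe_le_coe, coe_nnnorm, Real.coe_toNNReal _ hC0.le, e, norm_smul]
    have := norm_sub_le (fderiv ℝ (W V₂ V₁) y) (fderiv ℝ (W V₁ V₂) y)
    norm_num
    linarith [(b₁₂ y).2, (b₂₁ y).2]
  have hp1 : ∀ t, |p t| ≤ 1 / (4 * N ^ 2) := fun t => by
    simp only [hp]
    rw [abs_div, abs_of_pos (show 0 < 4 * N ^ 2 by positivity)]
    gcongr
    rw [abs_le]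
    constructor <;> nlinarith [Real.sin_sq_add_cos_sq (N ^ 2 * t), sq_nonneg (Real.sin (N ^ 2 * t)),
      sq_nonneg (Real.cos (N ^ 2 * t))]
  have hq1 : ∀ t, |q t| ≤ 1 / (4 * N ^ 2) := fun t => by
    have : q t = (2 * Real.sin (N ^ 2 * t) * Real.cos (N ^ 2 * t)) / (4 * N ^ 2) := by
      simp only [hq]; field_simp; norm_num
    rw [this, abs_div, abs_of_pos (show 0 < 4 * N ^ 2 by positivity)]
    gcongr
    rw [← Real.sin_two_mul]
    exact Real.abs_sin_le_one _
  have hzu : ∀ t, dist (z t) (u t) ≤ 3 * C / N := fun t => by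
    have e : z t - u t = (p t • A (u t) + q t • B (u t)) -
        ((Real.cos (N ^ 2 * t) / N) • V₁ (u t) + (Real.sin (N ^ 2 * t) / N) • V₂ (u t)) := by
      simp only [hz]; abel
    rw [dist_eq_norm, e]
    have h1 := norm_smul_add_smul_le (hp1 t) (hq1 t) (bA (u t)) (bB (u t))
    have h2 := norm_smul_add_smul_le (a := Real.cos (N ^ 2 * t) / N) (b := Real.sin (N ^ 2 * t) / N)
      (c := 1 / N) (d := 1 / N)
      (by rw [abs_div, abs_of_pos hN0]; gcongr; exact Real.abs_cos_le_one _)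
      (by rw [abs_div, abs_of_pos hN0]; gcongr; exact Real.abs_sin_le_one _)
      (hV₁b (u t)) (hV₂b (u t))
    have h3 : (1 / (4 * N ^ 2) + 1 / (4 * N ^ 2)) * (2 * C) ≤ C / N := by
      have : (1 / (4 * N ^ 2) + 1 / (4 * N ^ 2)) * (2 * C) = C / N ^ 2 := by field_simp; norm_num
      rw [this]
      gcongr
      nlinarith
    calc _ ≤ _ := norm_sub_le _ _
      _ ≤ C / N + (1 / N + 1 / N) * C := add_le_add (h1.trans h3) h2
      _ = 3 * C / N := by ring
  set u' : ℝ → E := fun t =>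
    (-N * Real.sin (N ^ 2 * t)) • V₁ (u t) + (N * Real.cos (N ^ 2 * t)) • V₂ (u t) with hu'
  set r : ℝ → E := fun t => p t • fderiv ℝ A (u t) (u' t) + q t • fderiv ℝ B (u t) (u' t) with hr
  have hu'b : ∀ t, ‖u' t‖ ≤ 2 * N * C := fun t => by
    have := norm_smul_add_smul_le (a := -N * Real.sin (N ^ 2 * t)) (b := N * Real.cos (N ^ 2 * t))
      (c := N) (d := N)
      (by rw [abs_mul, abs_neg, abs_of_pos hN0]
          exact mul_le_of_le_one_right hN0.le (Real.abs_sin_le_one _))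
      (by rw [abs_mul, abs_of_pos hN0]
          exact mul_le_of_le_one_right hN0.le (Real.abs_cos_le_one _))
      (hV₁b (u t)) (hV₂b (u t))
    linarith
  have hrb : ∀ t, ‖r t‖ ≤ 2 * C ^ 2 / N := fun t => by
    have := norm_smul_add_smul_le (hp1 t) (hq1 t)
      (((fderiv ℝ A (u t)).le_opNorm (u' t)).trans
        (mul_le_mul (bA' _) (hu'b t) (norm_nonneg _) (by positivity)))
      (((fderiv ℝ B (u t)).le_opNorm (u' t)).trans
        (mul_le_mul (bB' _) (hu'b t) (norm_nonneg _) (by positivity)))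
    refine this.trans (le_of_eq ?_)
    field_simp
    norm_num
  have hzd : ∀ t ∈ Set.Icc (0 : ℝ) 1, HasDerivAt z (F (u t) + r t) t := fun t ht => by
    have hut := hu t ht
    have hlin : HasDerivAt (fun t : ℝ => N ^ 2 * t) (N ^ 2) t := by
      simpa using (hasDerivAt_id t).const_mul (N ^ 2)
    have hcos := hlin.cos
    have hsin := hlin.sin
    have key := (hut.sub
      (((hcos.div_const N).smul ((hV₁ (u t)).hasFDerivAt.comp_hasDerivAt t hut)).add
      ((hsin.div_const N).smul ((hV₂ (u t)).hasFDerivAt.comp_hasDerivAt t hut)))).add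
      (((((hcos.pow 2).sub (hsin.pow 2)).div_const (4 * N ^ 2)).smul
          ((dA (u t)).hasFDerivAt.comp_hasDerivAt t hut)).add
        (((hsin.mul hcos).div_const (2 * N ^ 2)).smul
          ((dB (u t)).hasFDerivAt.comp_hasDerivAt t hut)))
    refine key.congr_deriv ?_
    have hcs := Real.sin_sq_add_cos_sq (N ^ 2 * t)
    simp only [hr]
    generalize fderiv ℝ A (u t) = LA
    generalize fderiv ℝ B (u t) = LB
    simp only [hF, hp, hq, hu', hA, hB, hW, map_add, map_smul, Function.comp_apply,
      Pi.sub_apply, Pi.pow_apply, Pi.mul_apply]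
    generalize Real.sin (N ^ 2 * t) = s at hcs ⊢
    generalize Real.cos (N ^ 2 * t) = c at hcs ⊢
    match_scalars
    all_goals field_simp
    all_goals ring_nf
    all_goals linarith
  have hza : ∀ t ∈ Set.Ico (0 : ℝ) 1, dist (F (u t) + r t) (F (z t)) ≤ 5 * C ^ 2 / N := fun t _ => by
    have h1 : dist (F (u t) + r t) (F (u t)) ≤ 2 * C ^ 2 / N := by simpa using hrb t
    have h2 := hFL.dist_le_mul (u t) (z t)
    rw [Real.coe_toNNReal _ hC0.le, dist_comm (u t)] at h2
    calc _ ≤ _ := dist_triangle _ (F (u t)) _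
      _ ≤ 2 * C ^ 2 / N + C * (3 * C / N) :=
        add_le_add h1 (h2.trans (mul_le_mul_of_nonneg_left (hzu t) hC0.le))
      _ = 5 * C ^ 2 / N := by ring
  have hgr := dist_le_of_approx_trajectories_ODE (v := fun _ => F) (K := C.toNNReal)
    (f := z) (g := x) (f' := fun t => F (u t) + r t) (g' := fun t => F (x t))
    (a := 0) (b := 1) (εf := 5 * C ^ 2 / N) (εg := 0) (δ := 3 * C / N) (fun _ => hFL)
    (fun t ht => (hzd t ht).continuousAt.continuousWithinAt)
    (fun t ht => (hzd t (Set.Ico_subset_Icc_self ht)).hasDerivWithinAt)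
    hza
    (fun t ht => (hx t ht).continuousAt.continuousWithinAt)
    (fun t ht => (hx t (Set.Ico_subset_Icc_self ht)).hasDerivWithinAt)
    (fun t _ => (dist_self _).le)
    (h0 ▸ hzu 0) t ht
  rw [Real.coe_toNNReal _ hC0.le, add_zero, sub_zero, gronwallBound_of_K_ne_0 hC0.ne'] at hgr
  have hexp : Real.exp (C * t) ≤ Real.exp C :=
    Real.exp_le_exp.2 (mul_le_of_le_one_right hC0.le ht.2)
  have h5 : 5 * C ^ 2 / N / C = 5 * C / N := by field_simp
  rw [h5] at hgr
  calc dist (u t) (x t) ≤ dist (u t) (z t) + dist (z t) (x t) := dist_triangle _ _ _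
    _ ≤ 3 * C / N + (3 * C / N * Real.exp C + 5 * C / N * Real.exp C) := by
      rw [dist_comm (u t)]
      refine add_le_add (hzu t) (hgr.trans (add_le_add (by gcongr) ?_))
      gcongr
      linarith
    _ = (3 * C + 8 * C * Real.exp C) / N := by ring

end Averaging

/-- Let `V₁, V₂ : ℝ² → ℝ²` be smooth vector fields, bounded with bounded derivatives of
every order. Let `xⁿ` solve `(xⁿ)′(t) = −n sin(n²t)·V₁(xⁿ_t) + n cos(n²t)·V₂(xⁿ_t)` with
`xⁿ_0 = ξ`, and let `x` solve `x′(t) = (1/2)·[V₁,V₂](x_t)` with `x_0 = ξ`, where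
`[V₁,V₂](y) = DV₂(y)(V₁(y)) − DV₁(y)(V₂(y))`. Then `xⁿ → x` uniformly on `[0,1]`. -/
theorem stmt8 (V₁ V₂ : EuclideanSpace ℝ (Fin 2) → EuclideanSpace ℝ (Fin 2))
    (hV₁ : ContDiff ℝ (⊤ : ℕ∞) V₁) (hV₂ : ContDiff ℝ (⊤ : ℕ∞) V₂)
    (hV₁b : ∀ k : ℕ, ∃ C : ℝ, ∀ y, ‖iteratedFDeriv ℝ k V₁ y‖ ≤ C)
    (hV₂b : ∀ k : ℕ, ∃ C : ℝ, ∀ y, ‖iteratedFDeriv ℝ k V₂ y‖ ≤ C)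
    (ξ : EuclideanSpace ℝ (Fin 2))
    (xn : ℕ → ℝ → EuclideanSpace ℝ (Fin 2)) (x : ℝ → EuclideanSpace ℝ (Fin 2))
    (hxn0 : ∀ n : ℕ, 1 ≤ n → xn n 0 = ξ)
    (hxn : ∀ n : ℕ, 1 ≤ n → ∀ t ∈ Set.Icc (0 : ℝ) 1,
      HasDerivAt (xn n)
        ((-(n : ℝ) * Real.sin ((n : ℝ) ^ 2 * t)) • V₁ (xn n t) +
          ((n : ℝ) * Real.cos ((n : ℝ) ^ 2 * t)) • V₂ (xn n t)) t)
    (hx0 : x 0 = ξ)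
    (hx : ∀ t ∈ Set.Icc (0 : ℝ) 1,
      HasDerivAt x
        ((1 / 2 : ℝ) • (fderiv ℝ V₂ (x t) (V₁ (x t)) - fderiv ℝ V₁ (x t) (V₂ (x t)))) t) :
    TendstoUniformlyOn (fun n => xn n) x Filter.atTop (Set.Icc (0 : ℝ) 1) := by
  obtain ⟨c₁, hc₁⟩ := hV₁b 0
  obtain ⟨c₂, hc₂⟩ := hV₂b 0
  simp only [norm_iteratedFDeriv_zero] at hc₁ hc₂
  have hle : ∀ {m : ℕ}, ((m : ℕ) : WithTop ℕ∞) ≤ ((⊤ : ℕ∞) : WithTop ℕ∞) := fun {m} => by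
    exact_mod_cast le_top
  have s₁ : ContDiff ℝ 2 V₁ := hV₁.of_le (hle (m := 2))
  have s₂ : ContDiff ℝ 2 V₂ := hV₂.of_le (hle (m := 2))
  have s₁' : ContDiff ℝ 1 V₁ := hV₁.of_le (hle (m := 1))
  have s₂' : ContDiff ℝ 1 V₂ := hV₂.of_le (hle (m := 1))
  obtain ⟨d₁₁, c₁₁, b₁₁⟩ := exists_bound_fderiv_apply s₁ s₁' hV₁b hV₁b
  obtain ⟨d₁₂, c₁₂, b₁₂⟩ := exists_bound_fderiv_apply s₁ s₂' hV₁b hV₂b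
  obtain ⟨d₂₁, c₂₁, b₂₁⟩ := exists_bound_fderiv_apply s₂ s₁' hV₂b hV₁b
  obtain ⟨d₂₂, c₂₂, b₂₂⟩ := exists_bound_fderiv_apply s₂ s₂' hV₂b hV₂b
  obtain ⟨C, hC⟩ := (Set.toFinite {1, c₁, c₂, c₁₁, c₁₂, c₂₁, c₂₂}).bddAbove
  simp only [mem_upperBounds, Set.mem_insert_iff, Set.mem_singleton_iff, forall_eq_or_imp,
    forall_eq] at hC
  obtain ⟨h1, hC₁, hC₂, hC₁₁, hC₁₂, hC₂₁, hC₂₂⟩ := hC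
  have hlim : Filter.Tendsto (fun n : ℕ => (3 * C + 8 * C * Real.exp C) / (n : ℝ))
      Filter.atTop (nhds 0) := tendsto_const_div_atTop_nhds_zero_nat _
  rw [Metric.tendstoUniformlyOn_iff]
  intro ε hε
  filter_upwards [hlim.eventually_lt_const hε, Filter.eventually_ge_atTop 1] with n hn hn1 t ht
  rw [dist_comm]
  refine lt_of_le_of_lt ?_ hn
  refine dist_le_of_circular_driver h1 (by exact_mod_cast hn1) rfl
    (s₁.differentiable (by norm_num)) (s₂.differentiable (by norm_num))
    (fun y => (hc₁ y).trans hC₁) (fun y => (hc₂ y).trans hC₂) ?_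
    ((hxn0 n hn1).trans hx0.symm) (hxn n hn1) hx ht
  rintro U (rfl | rfl) U' (rfl | rfl)
  · exact ⟨d₁₁, fun y => ⟨(b₁₁ y).1.trans hC₁₁, (b₁₁ y).2.trans hC₁₁⟩⟩
  · exact ⟨d₁₂, fun y => ⟨(b₁₂ y).1.trans hC₁₂, (b₁₂ y).2.trans hC₁₂⟩⟩
  · exact ⟨d₂₁, fun y => ⟨(b₂₁ y).1.trans hC₂₁, (b₂₁ y).2.trans hC₂₁⟩⟩
  · exact ⟨d₂₂, fun y => ⟨(b₂₂ y).1.trans hC₂₂, (b₂₂ y).2.trans hC₂₂⟩⟩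
end
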